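/- (Valiron) Let Φ be an analytic self-map of ℍ of hyperbolic type with Denjoy–Wolff point ∞ and dilation A > 1. Then for every orbit zₙ = Φⁿ(z₀), the limit θ(z₀) = lim_{n→∞} Arg zₙ exists in (0, π), and z₀ ↦ θ(z₀) is a harmonic function on ℍ. -/

import Mathlib

open Complex Filter Real

/-- A real sequence with vanishing increments whose absolute values converge is convergent. -/
theorem exists_tendsto_of_tendsto_abs {c : ℕ → ℝ} {L : ℝ}
    (hc : Tendsto (fun n => |c n|) atTop (nhds L))
    (hd : Tendsto (fun n => c (n + 1) - c n) atTop (nhds 0)) :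
    ∃ l, Tendsto c atTop (nhds l) := by
  have hL0 : 0 ≤ L := ge_of_tendsto' hc fun n => abs_nonneg _
  rcases hL0.eq_or_lt with rfl | hL
  · exact ⟨0, (tendsto_zero_iff_abs_tendsto_zero _).2 hc⟩
  have h1 : ∀ᶠ n in atTop, L / 2 < |c n| := hc.eventually_const_lt (by linarith)
  have h2 : ∀ᶠ n in atTop, |c (n + 1) - c n| < L := by
    have := hd.abs
    rw [abs_zero] at this
    exact this.eventually_lt_const hL
  obtain ⟨N, hN⟩ := eventually_atTop.1 (h1.and h2)
  rcases le_or_gt (c N) 0 with h0 | h0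
  · have key : ∀ n ≥ N, c n ≤ 0 := by
      intro n hn
      induction n, hn using Nat.le_induction with
      | base => exact h0
      | succ n hn ih =>
        have ha := (hN n hn).1
        have hb := (hN n hn).2
        have hc := (hN (n + 1) (by omega)).1
        rw [abs_lt] at hb
        rw [abs_of_nonpos ih] at ha
        by_contra! h
        rw [abs_of_pos h] at hc
        linarith [hb.2]
    refine ⟨-L, hc.neg.congr' ?_⟩
    filter_upwards [eventually_ge_atTop N] with n hn
    rw [abs_of_nonpos (key n hn), neg_neg]
  · have key : ∀ n ≥ N, 0 < c n := by
      intro n hn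
      induction n, hn using Nat.le_induction with
      | base => exact h0
      | succ n hn ih =>
        have ha := (hN n hn).1
        have hb := (hN n hn).2
        have hc := (hN (n + 1) (by omega)).1
        rw [abs_lt] at hb
        rw [abs_of_pos ih] at ha
        by_contra! h
        rw [abs_of_nonpos h] at hc
        linarith [hb.1]
    refine ⟨L, hc.congr' ?_⟩
    filter_upwards [eventually_ge_atTop N] with n hn
    rw [abs_of_pos (key n hn)]

theorem norm_sub_conj_sq (z w : ℂ) :
    ‖z - (starRingEnd ℂ) w‖ ^ 2 = ‖z - w‖ ^ 2 + 4 * (z.im * w.im) := by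
  simp only [Complex.sq_norm, Complex.normSq_apply, Complex.sub_re, Complex.sub_im,
    Complex.conj_re, Complex.conj_im]
  ring

theorem sub_conj_ne_zero {z w : ℂ} (hz : 0 ≤ z.im) (hw : 0 < w.im) :
    z - (starRingEnd ℂ) w ≠ 0 := by
  intro h
  have := congrArg Complex.im h
  simp at this
  linarith

/-- The **Schwarz–Pick inequality** for holomorphic self-maps of the upper half-plane. -/
theorem schwarz_pick_upperHalfPlane {f : ℂ → ℂ}
    (hd : DifferentiableOn ℂ f {z : ℂ | 0 < z.im})
    (hm : Set.MapsTo f {z : ℂ | 0 < z.im} {z : ℂ | 0 < z.im})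
    {z w : ℂ} (hz : 0 < z.im) (hw : 0 < w.im) :
    ‖f z - f w‖ ^ 2 * (z.im * w.im) ≤ ‖z - w‖ ^ 2 * ((f z).im * (f w).im) := by
  set C : ℂ → ℂ := fun u => (w - (starRingEnd ℂ) w * u) / (1 - u) with hC
  have hne : ∀ u ∈ Metric.ball (0 : ℂ) 1, (1 : ℂ) - u ≠ 0 := by
    intro u hu h
    rw [mem_ball_zero_iff] at hu
    have : u = 1 := by linear_combination -h
    simp [this] at hu
  have hCd : DifferentiableOn ℂ C (Metric.ball 0 1) :=
    DifferentiableOn.div (by fun_prop) (by fun_prop) hne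
  have hCm : Set.MapsTo C (Metric.ball 0 1) {z : ℂ | 0 < z.im} := by
    intro u hu
    have h1 := hne u hu
    have h2 : 0 < Complex.normSq (1 - u) := Complex.normSq_pos.2 h1
    have hu1 : Complex.normSq u < 1 := by
      rw [mem_ball_zero_iff] at hu
      rw [Complex.normSq_eq_norm_sq]
      nlinarith [norm_nonneg u]
    have h3 : (C u).im = w.im * (1 - Complex.normSq u) / Complex.normSq (1 - u) := by
      rw [hC]
      simp only [Complex.div_im]
      rw [← sub_div]
      congr 1
      simp only [Complex.normSq_apply, Complex.sub_re, Complex.sub_im,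
        Complex.conj_re, Complex.conj_im, Complex.mul_re, Complex.mul_im, Complex.one_re,
        Complex.one_im]
      ring
    change 0 < (C u).im
    rw [h3]
    exact div_pos (mul_pos hw (by linarith)) h2
  set g : ℂ → ℂ := fun u => (f (C u) - f w) / (f (C u) - (starRingEnd ℂ) (f w)) with hg
  have hfC : DifferentiableOn ℂ (fun u => f (C u)) (Metric.ball 0 1) := hd.comp hCd hCm
  have hgd : DifferentiableOn ℂ g (Metric.ball 0 1) :=
    DifferentiableOn.div (hfC.sub_const _) (hfC.sub_const _)
      fun u hu => sub_conj_ne_zero (hm (hCm hu)).le (hm hw)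
  have hgm : Set.MapsTo g (Metric.ball 0 1) (Metric.closedBall 0 1) := by
    intro u hu
    have h1 : 0 < (f (C u)).im := hm (hCm hu)
    have h2 : 0 < (f w).im := hm hw
    rw [mem_closedBall_zero_iff, hg]
    simp only [norm_div]
    refine div_le_one_of_le₀ ?_ (norm_nonneg _)
    refine (sq_le_sq₀ (by positivity) (norm_nonneg _)).1 ?_
    rw [norm_sub_conj_sq]
    nlinarith [mul_pos h1 h2]
  have hC0 : C 0 = w := by simp [hC]
  have hg0 : g 0 = 0 := by simp [hg, hC0]
  have hzw : 0 < ‖z - (starRingEnd ℂ) w‖ := norm_pos_iff.2 (sub_conj_ne_zero hz.le hw)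
  have hzw' := sub_conj_ne_zero hz.le hw
  set u : ℂ := (z - w) / (z - (starRingEnd ℂ) w) with hu
  have hu1 : ‖u‖ < 1 := by
    rw [hu, norm_div, div_lt_one hzw]
    refine lt_of_pow_lt_pow_left₀ 2 (norm_nonneg _) ?_
    rw [norm_sub_conj_sq]
    linarith [mul_pos hz hw]
  have hCu : C u = z := by
    have h1 : 1 - u ≠ 0 := hne u (mem_ball_zero_iff.2 hu1)
    rw [hC]
    simp only
    rw [div_eq_iff h1, hu]
    field_simp
    ring
  have key := Complex.norm_le_norm_of_mapsTo_ball hgd hgm hg0 hu1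
  have hgu : g u = (f z - f w) / (f z - (starRingEnd ℂ) (f w)) := by simp [hg, hCu]
  have hfz : 0 < (f z).im := hm hz
  have hfw : 0 < (f w).im := hm hw
  have hfzw : 0 < ‖f z - (starRingEnd ℂ) (f w)‖ := norm_pos_iff.2 (sub_conj_ne_zero hfz.le hfw)
  rw [hgu, hu, norm_div, norm_div, div_le_div_iff₀ hfzw hzw] at key
  have key2 := pow_le_pow_left₀ (by positivity) key 2
  rw [mul_pow, mul_pow, norm_sub_conj_sq, norm_sub_conj_sq] at key2
  linarith

/-- The **Schwarz–Pick inequality** for holomorphic maps into the closed upper half-plane. -/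
theorem schwarz_pick_upperHalfPlane_closed {f : ℂ → ℂ}
    (hd : DifferentiableOn ℂ f {z : ℂ | 0 < z.im})
    (hm : ∀ z : ℂ, 0 < z.im → 0 ≤ (f z).im)
    {z w : ℂ} (hz : 0 < z.im) (hw : 0 < w.im) :
    ‖f z - f w‖ ^ 2 * (z.im * w.im) ≤ ‖z - w‖ ^ 2 * ((f z).im * (f w).im) := by
  have h : ∀ δ : ℝ, 0 < δ →
      ‖f z - f w‖ ^ 2 * (z.im * w.im) ≤ ‖z - w‖ ^ 2 * (((f z).im + δ) * ((f w).im + δ)) := by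
    intro δ hδ
    have := schwarz_pick_upperHalfPlane (f := fun z => f z + δ * Complex.I) (hd.add_const _)
      (fun z hz => by simpa using add_pos_of_nonneg_of_pos (hm z hz) hδ) hz hw
    simpa using this
  have hlim : Tendsto (fun δ : ℝ => ‖z - w‖ ^ 2 * (((f z).im + δ) * ((f w).im + δ)))
      (nhdsWithin 0 (Set.Ioi 0)) (nhds (‖z - w‖ ^ 2 * (((f z).im + 0) * ((f w).im + 0)))) :=
    (Continuous.tendsto (by fun_prop) _).mono_left nhdsWithin_le_nhds
  simp only [add_zero] at hlim
  exact ge_of_tendsto hlim (eventually_mem_nhdsWithin.mono fun δ hδ => h δ hδ)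

theorem iterate_im_pos {Φ : ℂ → ℂ} (hm : Set.MapsTo Φ {z : ℂ | 0 < z.im} {z : ℂ | 0 < z.im})
    {z : ℂ} (hz : 0 < z.im) (n : ℕ) : 0 < (Φ^[n] z).im :=
  hm.iterate n hz

/-- The hyperbolic distance between two orbits, expressed through the point-pair invariant
`‖z - w‖ ^ 2 / (Im z * Im w)`, is nonincreasing. -/
theorem antitone_iterate_invariant {Φ : ℂ → ℂ}
    (hd : DifferentiableOn ℂ Φ {z : ℂ | 0 < z.im})
    (hm : Set.MapsTo Φ {z : ℂ | 0 < z.im} {z : ℂ | 0 < z.im})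
    {z w : ℂ} (hz : 0 < z.im) (hw : 0 < w.im) :
    Antitone fun n => ‖Φ^[n] z - Φ^[n] w‖ ^ 2 / ((Φ^[n] z).im * (Φ^[n] w).im) := by
  refine antitone_nat_of_succ_le fun n => ?_
  have h1 := iterate_im_pos hm hz n
  have h2 := iterate_im_pos hm hw n
  have h3 := iterate_im_pos hm hz (n + 1)
  have h4 := iterate_im_pos hm hw (n + 1)
  rw [div_le_div_iff₀ (by positivity) (by positivity)]
  rw [Function.iterate_succ_apply'] at h3 h4 ⊢
  rw [Function.iterate_succ_apply' (x := w)]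
  exact schwarz_pick_upperHalfPlane hd hm h1 h2

theorem exists_tendsto_iterate_invariant {Φ : ℂ → ℂ}
    (hd : DifferentiableOn ℂ Φ {z : ℂ | 0 < z.im})
    (hm : Set.MapsTo Φ {z : ℂ | 0 < z.im} {z : ℂ | 0 < z.im})
    {z w : ℂ} (hz : 0 < z.im) (hw : 0 < w.im) :
    ∃ D, Tendsto (fun n => ‖Φ^[n] z - Φ^[n] w‖ ^ 2 / ((Φ^[n] z).im * (Φ^[n] w).im))
      atTop (nhds D) := by
  refine ⟨_, tendsto_atTop_ciInf (antitone_iterate_invariant hd hm hz hw) ⟨0, ?_⟩⟩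
  rintro _ ⟨n, rfl⟩
  have h1 := iterate_im_pos hm hz n
  have h2 := iterate_im_pos hm hw n
  positivity

theorem mul_im_le_of_isGLB {Φ : ℂ → ℂ} {A : ℝ}
    (hA : IsGLB {r : ℝ | ∃ z : ℂ, 0 < z.im ∧ r = (Φ z).im / z.im} A) {z : ℂ} (hz : 0 < z.im) :
    A * z.im ≤ (Φ z).im :=
  (le_div_iff₀ hz).1 (hA.1 ⟨z, hz, rfl⟩)

/-- Orbits of a hyperbolic map stay in a Stolz angle. -/
theorem exists_norm_iterate_le_mul_im {Φ : ℂ → ℂ}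
    (hd : DifferentiableOn ℂ Φ {z : ℂ | 0 < z.im})
    (hm : Set.MapsTo Φ {z : ℂ | 0 < z.im} {z : ℂ | 0 < z.im})
    {A : ℝ} (hA1 : 1 < A) (hA : ∀ z : ℂ, 0 < z.im → A * z.im ≤ (Φ z).im)
    {z : ℂ} (hz : 0 < z.im) :
    ∃ K, ∀ n, ‖Φ^[n] z‖ ≤ K * (Φ^[n] z).im := by
  have hw : 0 < (Φ z).im := hm hz
  set D := ‖z - Φ z‖ ^ 2 / (z.im * (Φ z).im) with hD
  have hD0 : 0 ≤ D := by positivity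
  have hstep : ∀ n, ‖Φ^[n + 1] z‖ ≤ ‖Φ^[n] z‖ + √D * (Φ^[n + 1] z).im := by
    intro n
    have h1 := iterate_im_pos hm hz n
    have h2 := iterate_im_pos hm hz (n + 1)
    have h3 : ‖Φ^[n] z - Φ^[n + 1] z‖ ^ 2 / ((Φ^[n] z).im * (Φ^[n + 1] z).im) ≤ D :=
      antitone_iterate_invariant hd hm hz hw (Nat.zero_le n)
    rw [div_le_iff₀ (by positivity)] at h3
    have h4 : (Φ^[n] z).im ≤ (Φ^[n + 1] z).im := by
      rw [Function.iterate_succ_apply']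
      nlinarith [hA _ h1]
    have h5 : ‖Φ^[n + 1] z - Φ^[n] z‖ ≤ √D * (Φ^[n + 1] z).im := by
      rw [norm_sub_rev]
      refine (sq_le_sq₀ (by positivity) (by positivity)).1 ?_
      rw [mul_pow, Real.sq_sqrt hD0]
      refine h3.trans (mul_le_mul_of_nonneg_left ?_ hD0)
      rw [sq]
      exact mul_le_mul_of_nonneg_right h4 h2.le
    have h6 := norm_le_norm_add_norm_sub' (Φ^[n + 1] z) (Φ^[n] z)
    linarith
  have hA' : 0 < A - 1 := by linarith
  refine ⟨‖z‖ / z.im + √D * A / (A - 1), fun n => ?_⟩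
  induction n with
  | zero =>
    have : ‖z‖ / z.im * z.im = ‖z‖ := by field_simp
    have : 0 ≤ √D * A / (A - 1) * z.im := by positivity
    simp only [Function.iterate_zero, id]
    linarith
  | succ n ih =>
    have h1 := iterate_im_pos hm hz n
    have h4 : A * (Φ^[n] z).im ≤ (Φ^[n + 1] z).im := by
      rw [Function.iterate_succ_apply']
      exact hA _ h1
    have h5 := hstep n
    set y := (Φ^[n] z).im
    set y' := (Φ^[n + 1] z).im
    have h6 : ‖z‖ / z.im * y ≤ ‖z‖ / z.im * y' :=
      mul_le_mul_of_nonneg_left (by nlinarith) (by positivity)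
    have h7 : √D * A / (A - 1) * y ≤ √D / (A - 1) * y' := by
      have : √D * A / (A - 1) * y = √D / (A - 1) * (A * y) := by ring
      rw [this]
      exact mul_le_mul_of_nonneg_left h4 (by positivity)
    have h8 : √D * A / (A - 1) * y' = √D / (A - 1) * y' + √D * y' := by
      field_simp
      ring
    linarith

theorem tendsto_iterate_im_atTop {Φ : ℂ → ℂ} {A : ℝ} (hA1 : 1 < A)
    (hm : Set.MapsTo Φ {z : ℂ | 0 < z.im} {z : ℂ | 0 < z.im})
    (hA : ∀ z : ℂ, 0 < z.im → A * z.im ≤ (Φ z).im) {z : ℂ} (hz : 0 < z.im) :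
    Tendsto (fun n => (Φ^[n] z).im) atTop atTop := by
  refine tendsto_atTop_mono (f := fun n => A ^ n * z.im) (fun n => ?_)
    ((tendsto_pow_atTop_atTop_of_one_lt hA1).atTop_mul_const hz)
  induction n with
  | zero => simp
  | succ n ih =>
    have h := hA _ (iterate_im_pos hm hz n)
    rw [Function.iterate_succ_apply', pow_succ]
    nlinarith

/-- The angular derivative at infinity is attained along every orbit. -/
theorem tendsto_norm_iterate_sub_mul_div_im {Φ : ℂ → ℂ}
    (hd : DifferentiableOn ℂ Φ {z : ℂ | 0 < z.im})
    (hm : Set.MapsTo Φ {z : ℂ | 0 < z.im} {z : ℂ | 0 < z.im})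
    {A : ℝ} (hA1 : 1 < A)
    (hA : IsGLB {r : ℝ | ∃ z : ℂ, 0 < z.im ∧ r = (Φ z).im / z.im} A)
    {z : ℂ} (hz : 0 < z.im) :
    Tendsto (fun n => ‖Φ^[n + 1] z - A * Φ^[n] z‖ / (Φ^[n] z).im) atTop (nhds 0) := by
  have hA' : ∀ z : ℂ, 0 < z.im → A * z.im ≤ (Φ z).im := fun z hz => mul_im_le_of_isGLB hA hz
  obtain ⟨K, hK⟩ := exists_norm_iterate_le_mul_im hd hm hA1 hA' hz
  have hy := tendsto_iterate_im_atTop hA1 hm hA' hz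
  set p : ℂ → ℂ := fun z => Φ z - A * z with hp
  have hpd : DifferentiableOn ℂ p {z : ℂ | 0 < z.im} := hd.sub (by fun_prop)
  have hpim : ∀ z, (p z).im = (Φ z).im - A * z.im := fun z => by simp [hp]
  have hpm : ∀ z : ℂ, 0 < z.im → 0 ≤ (p z).im := fun z hz => by
    rw [hpim]; linarith [hA' z hz]
  have main : ∀ ε : ℝ, 0 < ε → ∀ᶠ n in atTop,
      ‖p (Φ^[n] z)‖ / (Φ^[n] z).im ≤ 2 * ε + (K + 1) ^ 2 * ε := by
    intro ε hε
    obtain ⟨_, ⟨w, hw, rfl⟩, -, hwε⟩ := hA.exists_between (show A < A + ε by linarith)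
    have hpw : (p w).im ≤ ε * w.im := by
      rw [div_lt_iff₀ hw] at hwε
      rw [hpim]
      linarith
    filter_upwards [hy.eventually_ge_atTop (‖p w‖ / ε), hy.eventually_ge_atTop ‖w‖] with n h1 h2
    have hyn := iterate_im_pos hm hz n
    have hKn := hK n
    set ζ := Φ^[n] z
    set y := ζ.im
    have hsp := schwarz_pick_upperHalfPlane_closed hpd hpm hyn hw
    set q := ‖p ζ‖ / y with hq
    have hq0 : 0 ≤ q := by positivity
    have hpq : ‖p ζ‖ = q * y := by rw [hq]; field_simp
    have hpζ : (p ζ).im ≤ q * y := hpq ▸ (le_abs_self _).trans (Complex.abs_im_le_norm _)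
    have hzw : ‖ζ - w‖ ≤ (K + 1) * y := by linarith [norm_sub_le ζ w]
    have hzw2 : ‖ζ - w‖ ^ 2 ≤ ((K + 1) * y) ^ 2 := pow_le_pow_left₀ (norm_nonneg _) hzw 2
    have h3 : ‖p ζ - p w‖ ^ 2 * (y * w.im) ≤ (((K + 1) * y) ^ 2 * (q * ε)) * (y * w.im) := by
      calc _ ≤ ‖ζ - w‖ ^ 2 * ((p ζ).im * (p w).im) := hsp
        _ ≤ ((K + 1) * y) ^ 2 * ((q * y) * (ε * w.im)) := by
          gcongr
          · exact mul_nonneg (hpm ζ hyn) (hpm w hw)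
          · exact hpm w hw
        _ = _ := by ring
    have h4 : ‖p ζ - p w‖ ^ 2 ≤ ((K + 1) * y) ^ 2 * (q * ε) :=
      le_of_mul_le_mul_right h3 (by positivity)
    have h5 : ‖p ζ - p w‖ ≤ ((K + 1) ^ 2 * ε / 2 + q / 2) * y := by
      refine (sq_le_sq₀ (by positivity) (by positivity)).1 (h4.trans ?_)
      have := mul_nonneg (sq_nonneg ((K + 1) ^ 2 * ε - q)) (sq_nonneg y)
      nlinarith
    have h6 : ‖p w‖ ≤ ε * y := by
      rw [div_le_iff₀ hε] at h1
      linarith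
    have h7 : q * y ≤ (ε + (K + 1) ^ 2 * ε / 2 + q / 2) * y := by
      have := norm_le_norm_add_norm_sub' (p ζ) (p w)
      rw [hpq] at this
      linarith
    have h8 := le_of_mul_le_mul_right h7 hyn
    linarith
  have hfun : (fun n => ‖Φ^[n + 1] z - A * Φ^[n] z‖ / (Φ^[n] z).im) =
      fun n => ‖p (Φ^[n] z)‖ / (Φ^[n] z).im := by
    funext n
    rw [Function.iterate_succ_apply']
  rw [hfun, Metric.tendsto_nhds]
  intro ε hε
  have hK' : 0 < 2 + (K + 1) ^ 2 := by positivity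
  filter_upwards [main (ε / (2 * (2 + (K + 1) ^ 2))) (by positivity)] with n hn
  have hyn := iterate_im_pos hm hz n
  rw [Real.dist_eq, sub_zero, abs_of_nonneg (by positivity)]
  have : 2 * (ε / (2 * (2 + (K + 1) ^ 2))) + (K + 1) ^ 2 * (ε / (2 * (2 + (K + 1) ^ 2)))
      = ε / 2 := by
    field_simp
  linarith

/-- Along an orbit of a hyperbolic map, the imaginary part grows by the factor `A` in the limit. -/
theorem tendsto_iterate_succ_im_div_im {Φ : ℂ → ℂ}
    (hd : DifferentiableOn ℂ Φ {z : ℂ | 0 < z.im})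
    (hm : Set.MapsTo Φ {z : ℂ | 0 < z.im} {z : ℂ | 0 < z.im})
    {A : ℝ} (hA1 : 1 < A)
    (hA : IsGLB {r : ℝ | ∃ z : ℂ, 0 < z.im ∧ r = (Φ z).im / z.im} A)
    {z : ℂ} (hz : 0 < z.im) :
    Tendsto (fun n => (Φ^[n + 1] z).im / (Φ^[n] z).im) atTop (nhds A) := by
  rw [← tendsto_sub_nhds_zero_iff]
  refine squeeze_zero_norm (fun n => ?_) (tendsto_norm_iterate_sub_mul_div_im hd hm hA1 hA hz)
  have hy := iterate_im_pos hm hz n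
  rw [Real.norm_eq_abs, div_sub' hy.ne', abs_div, abs_of_pos hy]
  gcongr
  have := Complex.abs_im_le_norm (Φ^[n + 1] z - A * Φ^[n] z)
  simpa [mul_comm] using this

theorem tendsto_norm_iterate_succ_div_norm {Φ : ℂ → ℂ}
    (hd : DifferentiableOn ℂ Φ {z : ℂ | 0 < z.im})
    (hm : Set.MapsTo Φ {z : ℂ | 0 < z.im} {z : ℂ | 0 < z.im})
    {A : ℝ} (hA1 : 1 < A)
    (hA : IsGLB {r : ℝ | ∃ z : ℂ, 0 < z.im ∧ r = (Φ z).im / z.im} A)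
    {z : ℂ} (hz : 0 < z.im) :
    Tendsto (fun n => ‖Φ^[n + 1] z‖ / ‖Φ^[n] z‖) atTop (nhds A) := by
  rw [← tendsto_sub_nhds_zero_iff]
  refine squeeze_zero_norm (fun n => ?_) (tendsto_norm_iterate_sub_mul_div_im hd hm hA1 hA hz)
  have hy := iterate_im_pos hm hz n
  have hy' : (Φ^[n] z).im ≤ ‖Φ^[n] z‖ := (le_abs_self _).trans (Complex.abs_im_le_norm _)
  have hn := hy.trans_le hy'
  rw [Real.norm_eq_abs, div_sub' hn.ne', abs_div, abs_of_pos hn]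
  have h := abs_norm_sub_norm_le (Φ^[n + 1] z) (A * Φ^[n] z)
  rw [norm_mul, Complex.norm_real, Real.norm_of_nonneg (by linarith), mul_comm A] at h
  gcongr

/-- Orbits of a hyperbolic map have a limiting direction. -/
theorem exists_tendsto_iterate_div_im {Φ : ℂ → ℂ}
    (hd : DifferentiableOn ℂ Φ {z : ℂ | 0 < z.im})
    (hm : Set.MapsTo Φ {z : ℂ | 0 < z.im} {z : ℂ | 0 < z.im})
    {A : ℝ} (hA1 : 1 < A)
    (hA : IsGLB {r : ℝ | ∃ z : ℂ, 0 < z.im ∧ r = (Φ z).im / z.im} A)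
    {z : ℂ} (hz : 0 < z.im) :
    ∃ u : ℂ, 0 < u.im ∧
      Tendsto (fun n => Φ^[n] z / ((Φ^[n] z).im : ℂ)) atTop (nhds u) := by
  have hA' : ∀ z : ℂ, 0 < z.im → A * z.im ≤ (Φ z).im := fun z hz => mul_im_le_of_isGLB hA hz
  obtain ⟨K, hK⟩ := exists_norm_iterate_le_mul_im hd hm hA1 hA' hz
  have hq := tendsto_norm_iterate_sub_mul_div_im hd hm hA1 hA hz
  have hr := tendsto_iterate_succ_im_div_im hd hm hA1 hA hz
  obtain ⟨D, hD⟩ := exists_tendsto_iterate_invariant hd hm hz (hm hz)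
  have hypos := iterate_im_pos hm hz
  set c : ℕ → ℝ := fun n => (Φ^[n] z).re / (Φ^[n] z).im with hc
  have hA1' : 0 < A - 1 := by linarith
  have hstep : Tendsto (fun n => ‖Φ^[n + 1] z - Φ^[n] z‖ / (Φ^[n] z).im) atTop
      (nhds (√(D * A))) := by
    refine (hD.mul hr).sqrt.congr fun n => ?_
    have h1 := hypos n
    have h2 : 0 < (Φ^[n] (Φ z)).im := hypos (n + 1)
    have h3 : ‖Φ^[n] z - Φ^[n] (Φ z)‖ ^ 2 / ((Φ^[n] z).im * (Φ^[n] (Φ z)).im) *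
        ((Φ^[n] (Φ z)).im / (Φ^[n] z).im) =
        (‖Φ^[n] (Φ z) - Φ^[n] z‖ / (Φ^[n] z).im) ^ 2 := by
      rw [norm_sub_rev]
      field_simp
    exact (congrArg Real.sqrt h3).trans (Real.sqrt_sq (by positivity))
  have hnorm : Tendsto (fun n => ‖Φ^[n] z‖ / (Φ^[n] z).im) atTop
      (nhds (√(D * A) / (A - 1))) := by
    have hdiff : Tendsto (fun n => (A - 1) * (‖Φ^[n] z‖ / (Φ^[n] z).im) -
        ‖Φ^[n + 1] z - Φ^[n] z‖ / (Φ^[n] z).im) atTop (nhds 0) := by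
      refine squeeze_zero_norm (fun n => ?_) hq
      have hy := hypos n
      rw [Real.norm_eq_abs, ← mul_div_assoc, ← sub_div, abs_div, abs_of_pos hy]
      gcongr
      have h := abs_norm_sub_norm_le (((A - 1 : ℝ) : ℂ) * Φ^[n] z) (Φ^[n + 1] z - Φ^[n] z)
      rw [norm_mul, Complex.norm_real, Real.norm_of_nonneg hA1'.le] at h
      refine h.trans_eq ?_
      rw [← norm_neg]
      congr 1
      push_cast
      ring
    have h := (hdiff.add hstep).div_const (A - 1)
    rw [zero_add] at h
    refine h.congr fun n => ?_
    field_simp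
    ring
  have habs : Tendsto (fun n => |c n|) atTop (nhds √((√(D * A) / (A - 1)) ^ 2 - 1)) := by
    refine ((hnorm.pow 2).sub_const 1).sqrt.congr fun n => ?_
    have hy := hypos n
    rw [← Real.sqrt_sq_eq_abs]
    congr 1
    rw [hc]
    simp only [div_pow, Complex.sq_norm, Complex.normSq_apply]
    field_simp
    ring
  have hdc : Tendsto (fun n => c (n + 1) - c n) atTop (nhds 0) := by
    have h0 := hq.mul_const (1 + K)
    rw [zero_mul] at h0
    refine squeeze_zero_norm (fun n => ?_) h0
    have hy := hypos n
    have hy1 := hypos (n + 1)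
    have hle : (Φ^[n] z).im ≤ (Φ^[n + 1] z).im := by
      have := hA' _ hy
      rw [Function.iterate_succ_apply']
      nlinarith
    have hre := Complex.abs_re_le_norm (Φ^[n + 1] z - A * Φ^[n] z)
    have him := Complex.abs_im_le_norm (Φ^[n + 1] z - A * Φ^[n] z)
    have hx : |(Φ^[n] z).re| ≤ K * (Φ^[n] z).im := (Complex.abs_re_le_norm _).trans (hK n)
    set P := ‖Φ^[n + 1] z - A * Φ^[n] z‖
    simp only [Complex.sub_re, Complex.sub_im, Complex.re_ofReal_mul,
      Complex.im_ofReal_mul] at hre him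
    rw [hc]
    simp only
    set x := (Φ^[n] z).re
    set y := (Φ^[n] z).im
    set x' := (Φ^[n + 1] z).re
    set y' := (Φ^[n + 1] z).im
    have hP : 0 ≤ P := norm_nonneg _
    have hK0 : 0 ≤ K := nonneg_of_mul_nonneg_left ((abs_nonneg x).trans hx) hy
    have e : x' / y' - x / y = ((x' - A * x) * y - x * (y' - A * y)) / (y' * y) := by
      field_simp
      ring
    rw [e, Real.norm_eq_abs, abs_div, abs_of_pos (mul_pos hy1 hy)]
    calc _ ≤ (P * y + K * y * P) / (y' * y) := by
          gcongr
          refine (abs_sub _ _).trans ?_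
          rw [abs_mul, abs_mul, abs_of_pos hy]
          gcongr
      _ ≤ (P * y + K * y * P) / (y * y) := by gcongr
      _ = P / y * (1 + K) := by field_simp
  obtain ⟨l, hl⟩ := exists_tendsto_of_tendsto_abs habs hdc
  refine ⟨l + Complex.I, by simp, ?_⟩
  have h : Tendsto (fun n => ((c n : ℝ) : ℂ) + Complex.I) atTop (nhds (l + Complex.I)) :=
    ((Complex.continuous_ofReal.tendsto l).comp hl).add_const _
  refine h.congr fun n => ?_
  have hy : ((Φ^[n] z).im : ℂ) ≠ 0 := Complex.ofReal_ne_zero.2 (hypos n).ne'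
  rw [eq_div_iff hy, add_mul, hc]
  simp only
  rw [Complex.ofReal_div, div_mul_cancel₀ _ hy, mul_comm Complex.I, Complex.re_add_im]

/-- The ratio of the moduli of two orbits of a hyperbolic map converges to a positive limit. -/
theorem exists_tendsto_norm_iterate_div_norm {Φ : ℂ → ℂ}
    (hd : DifferentiableOn ℂ Φ {z : ℂ | 0 < z.im})
    (hm : Set.MapsTo Φ {z : ℂ | 0 < z.im} {z : ℂ | 0 < z.im})
    {A : ℝ} (hA1 : 1 < A)
    (hA : IsGLB {r : ℝ | ∃ z : ℂ, 0 < z.im ∧ r = (Φ z).im / z.im} A)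
    {z w : ℂ} (hz : 0 < z.im) (hw : 0 < w.im) :
    ∃ ρ : ℝ, 0 < ρ ∧ Tendsto (fun n => ‖Φ^[n] z‖ / ‖Φ^[n] w‖) atTop (nhds ρ) := by
  have hn : ∀ {z : ℂ}, 0 < z.im → ∀ n, 0 < ‖Φ^[n] z‖ := fun hz n =>
    (iterate_im_pos hm hz n).trans_le ((le_abs_self _).trans (Complex.abs_im_le_norm _))
  have hnz := hn hz
  have hnw := hn hw
  obtain ⟨u, hu0, hu⟩ := exists_tendsto_iterate_div_im hd hm hA1 hA hz
  obtain ⟨v, hv0, hv⟩ := exists_tendsto_iterate_div_im hd hm hA1 hA hw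
  obtain ⟨D, hD⟩ := exists_tendsto_iterate_invariant hd hm hz hw
  have hune : u ≠ 0 := fun h => by simp [h] at hu0
  have hvne : v ≠ 0 := fun h => by simp [h] at hv0
  set s : ℕ → ℝ := fun n => Real.log (‖Φ^[n] z‖ / ‖Φ^[n] w‖) with hs
  have hcosh : ∃ M, Tendsto (fun n => Real.cosh (s n)) atTop (nhds M) := by
    have huv : Tendsto (fun n => (Φ^[n] z / ((Φ^[n] z).im : ℂ) *
        (starRingEnd ℂ) (Φ^[n] w / ((Φ^[n] w).im : ℂ))).re) atTop
        (nhds (u * (starRingEnd ℂ) v).re) :=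
      (Complex.continuous_re.tendsto _).comp
        (hu.mul ((Complex.continuous_conj.tendsto _).comp hv))
    refine ⟨_, ((((hD.add (huv.const_mul 2)).div (hu.norm.mul hv.norm)
      (mul_ne_zero (norm_ne_zero_iff.2 hune) (norm_ne_zero_iff.2 hvne)))).div_const 2).congr
      fun n => ?_⟩
    have h1 := iterate_im_pos hm hz n
    have h2 := iterate_im_pos hm hw n
    have h3 := hnz n
    have h4 := hnw n
    rw [hs]
    simp only
    rw [Real.cosh_log (by positivity)]
    have e : ‖Φ^[n] z - Φ^[n] w‖ ^ 2 = ‖Φ^[n] z‖ ^ 2 + ‖Φ^[n] w‖ ^ 2 -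
        2 * (Φ^[n] z * (starRingEnd ℂ) (Φ^[n] w)).re := by
      simp only [Complex.sq_norm, Complex.normSq_sub]
    have e2 : (Φ^[n] z / ((Φ^[n] z).im : ℂ) *
        (starRingEnd ℂ) (Φ^[n] w / ((Φ^[n] w).im : ℂ))).re =
        (Φ^[n] z * (starRingEnd ℂ) (Φ^[n] w)).re / ((Φ^[n] z).im * (Φ^[n] w).im) := by
      rw [map_div₀, Complex.conj_ofReal, div_mul_div_comm, ← Complex.ofReal_mul,
        Complex.div_ofReal_re]
    rw [Pi.div_apply, e, e2, norm_div, norm_div, Complex.norm_real, Complex.norm_real,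
      Real.norm_of_nonneg h1.le, Real.norm_of_nonneg h2.le]
    field_simp
    ring
  obtain ⟨M, hM⟩ := hcosh
  have habs : Tendsto (fun n => |s n|) atTop (nhds (Real.arsinh √(M ^ 2 - 1))) := by
    refine ((Real.continuous_arsinh.tendsto _).comp ((hM.pow 2).sub_const 1).sqrt).congr
      fun n => ?_
    have : Real.cosh (s n) ^ 2 - 1 = Real.sinh (s n) ^ 2 := by
      linarith [Real.cosh_sq (s n)]
    simp only [Function.comp_apply]
    rw [this, Real.sqrt_sq_eq_abs, Real.abs_sinh, Real.arsinh_sinh]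
  have hds : Tendsto (fun n => s (n + 1) - s n) atTop (nhds 0) := by
    have hA0 : A ≠ 0 := by linarith
    have h := ((tendsto_norm_iterate_succ_div_norm hd hm hA1 hA hz).div
      (tendsto_norm_iterate_succ_div_norm hd hm hA1 hA hw) hA0).log (div_ne_zero hA0 hA0)
    rw [div_self hA0, Real.log_one] at h
    refine h.congr fun n => ?_
    have h1 := hnz n
    have h2 := hnw n
    have h3 := hnz (n + 1)
    have h4 := hnw (n + 1)
    rw [hs]
    simp only [Pi.div_apply]
    rw [← Real.log_div (by positivity) (by positivity)]
    congr 1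
    field_simp
  obtain ⟨l, hl⟩ := exists_tendsto_of_tendsto_abs habs hds
  refine ⟨Real.exp l, Real.exp_pos l, hl.rexp.congr fun n => ?_⟩
  exact Real.exp_log (div_pos (hnz n) (hnw n))

/-- The iterates of a hyperbolic map, normalized by the modulus of a reference orbit,
converge pointwise. -/
theorem exists_tendsto_iterate_div_norm {Φ : ℂ → ℂ}
    (hd : DifferentiableOn ℂ Φ {z : ℂ | 0 < z.im})
    (hm : Set.MapsTo Φ {z : ℂ | 0 < z.im} {z : ℂ | 0 < z.im})
    {A : ℝ} (hA1 : 1 < A)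
    (hA : IsGLB {r : ℝ | ∃ z : ℂ, 0 < z.im ∧ r = (Φ z).im / z.im} A)
    {z w : ℂ} (hz : 0 < z.im) (hw : 0 < w.im) :
    ∃ g : ℂ, 0 < g.im ∧ Tendsto (fun n => Φ^[n] z / (‖Φ^[n] w‖ : ℂ)) atTop (nhds g) := by
  obtain ⟨u, hu0, hu⟩ := exists_tendsto_iterate_div_im hd hm hA1 hA hz
  obtain ⟨ρ, hρ0, hρ⟩ := exists_tendsto_norm_iterate_div_norm hd hm hA1 hA hz hw
  have hune : u ≠ 0 := fun h => by simp [h] at hu0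
  have hunorm : 0 < ‖u‖ := norm_pos_iff.2 hune
  refine ⟨((ρ / ‖u‖ : ℝ) : ℂ) * u, ?_, ?_⟩
  · rw [Complex.im_ofReal_mul]
    positivity
  have h := ((Complex.continuous_ofReal.tendsto _).comp
    (hρ.div hu.norm hunorm.ne')).mul hu
  refine h.congr fun n => ?_
  have h1 := iterate_im_pos hm hz n
  have hzn : Φ^[n] z ≠ 0 := fun h => by simp [h] at h1
  have h2 : (‖Φ^[n] z‖ : ℂ) ≠ 0 := by simpa using hzn
  have h3 : ((Φ^[n] z).im : ℂ) ≠ 0 := Complex.ofReal_ne_zero.2 h1.ne'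
  simp only [Function.comp_apply, Pi.div_apply, norm_div, Complex.norm_real,
    Real.norm_of_nonneg h1.le, Complex.ofReal_div]
  field_simp

/-- A pointwise convergent sequence which is equicontinuous at every point of `s` converges
locally uniformly on `s`. -/
theorem tendstoLocallyUniformlyOn_of_equicontinuousAt {F : ℕ → ℂ → ℂ} {f : ℂ → ℂ} {s : Set ℂ}
    (hs : IsOpen s) (hF : ∀ x ∈ s, EquicontinuousAt F x)
    (hlim : ∀ x ∈ s, Tendsto (fun n => F n x) atTop (nhds (f x))) :
    TendstoLocallyUniformlyOn F f atTop s := by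
  rw [Metric.tendstoLocallyUniformlyOn_iff]
  intro ε hε x hx
  have h1 := (Metric.equicontinuousAt_iff_right.1 (hF x hx)) (ε / 3) (by positivity)
  refine ⟨_, inter_mem (mem_nhdsWithin_of_mem_nhds h1)
    (mem_nhdsWithin_of_mem_nhds (hs.mem_nhds hx)), ?_⟩
  filter_upwards [(Metric.tendsto_nhds.1 (hlim x hx)) (ε / 3) (by positivity)] with n hn
  rintro y ⟨hy, hys⟩
  have h2 : dist (f x) (f y) ≤ ε / 3 :=
    le_of_tendsto' ((hlim x hx).dist (hlim y hys)) fun n => (hy n).le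
  have h3 := hy n
  rw [dist_comm] at h2 hn
  linarith [dist_triangle4 (f y) (f x) (F n x) (F n y)]

/-- A sequence of holomorphic self-maps of the upper half-plane is equicontinuous at each point
at which it is bounded. -/
theorem equicontinuousAt_of_mapsTo_upperHalfPlane {F : ℕ → ℂ → ℂ}
    (hd : ∀ n, DifferentiableOn ℂ (F n) {z : ℂ | 0 < z.im})
    (hm : ∀ n, Set.MapsTo (F n) {z : ℂ | 0 < z.im} {z : ℂ | 0 < z.im})
    {x : ℂ} (hx : 0 < x.im) {M : ℝ} (hM : ∀ n, ‖F n x‖ ≤ M) : EquicontinuousAt F x := by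
  have hM0 : 0 ≤ M := (norm_nonneg _).trans (hM 0)
  set κ : ℂ → ℝ := fun y => ‖x - y‖ ^ 2 / (x.im * y.im) with hκ
  have hκc : ContinuousAt κ x :=
    ContinuousAt.div (by fun_prop) (by fun_prop) (mul_pos hx hx).ne'
  have hκ0 : κ x = 0 := by simp [hκ]
  have hb : Tendsto (fun y => M * √(2 * κ y + κ y ^ 2)) (nhds x) (nhds 0) := by
    have : ContinuousAt (fun y => M * √(2 * κ y + κ y ^ 2)) x := by fun_prop
    simpa [ContinuousAt, hκ0] using this
  have hopen : IsOpen {z : ℂ | 0 < z.im} := isOpen_lt continuous_const Complex.continuous_im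
  refine Metric.equicontinuousAt_of_continuity_modulus _ hb _ ?_
  filter_upwards [hopen.mem_nhds hx] with y hy n
  have hy : 0 < y.im := hy
  have hκy : 0 ≤ κ y := by positivity
  have h1 := schwarz_pick_upperHalfPlane (hd n) (hm n) hx hy
  have h2 : 0 < (F n x).im := hm n hx
  have h3 : 0 < (F n y).im := hm n hy
  have h4 : (F n x).im ≤ M := ((le_abs_self _).trans (Complex.abs_im_le_norm _)).trans (hM n)
  rw [dist_eq_norm]
  set t := ‖F n x - F n y‖
  have h5 : (F n y).im ≤ M + t := by
    have := (le_abs_self _).trans (Complex.abs_im_le_norm (F n y))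
    have := norm_le_norm_add_norm_sub (F n x) (F n y)
    linarith [hM n]
  have h6 : t ^ 2 ≤ κ y * (M * (M + t)) := by
    rw [hκ]
    simp only
    rw [div_mul_eq_mul_div, le_div_iff₀ (by positivity)]
    refine h1.trans ?_
    gcongr
  refine (sq_le_sq₀ (norm_nonneg _) (by positivity)).1 ?_
  rw [mul_pow, Real.sq_sqrt (by positivity)]
  nlinarith [sq_nonneg (κ y * M - t)]

/-- Valiron's Property (2)(a): the arguments of an orbit converge, and the limit is a
harmonic function of the starting point (expressed as the real part of a holomorphic
function on the upper half-plane). -/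
theorem valiron_argument_limit (Φ : ℂ → ℂ)
    (hd : DifferentiableOn ℂ Φ {z : ℂ | 0 < z.im})
    (hm : Set.MapsTo Φ {z : ℂ | 0 < z.im} {z : ℂ | 0 < z.im})
    (A : ℝ) (hA1 : 1 < A)
    (hA : IsGLB {r : ℝ | ∃ z : ℂ, 0 < z.im ∧ r = (Φ z).im / z.im} A) :
    ∃ θ : ℂ → ℝ,
      (∀ z₀ : ℂ, 0 < z₀.im → θ z₀ ∈ Set.Ioo 0 π ∧
        Tendsto (fun n => Complex.arg (Φ^[n] z₀)) atTop (nhds (θ z₀))) ∧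
      ∃ h : ℂ → ℂ, DifferentiableOn ℂ h {z : ℂ | 0 < z.im} ∧
        ∀ z ∈ {z : ℂ | 0 < z.im}, θ z = (h z).re := by
  have hI : 0 < Complex.I.im := by simp
  have hlim : ∀ z : ℂ, ∃ g : ℂ, 0 < z.im → 0 < g.im ∧
      Tendsto (fun n => Φ^[n] z / (‖Φ^[n] Complex.I‖ : ℂ)) atTop (nhds g) := by
    intro z
    by_cases hz : 0 < z.im
    · obtain ⟨g, hg⟩ := exists_tendsto_iterate_div_norm hd hm hA1 hA hz hI
      exact ⟨g, fun _ => hg⟩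
    · exact ⟨0, fun h => absurd h hz⟩
  choose G hG using hlim
  have hIn : ∀ n, 0 < ‖Φ^[n] Complex.I‖ := fun n =>
    (iterate_im_pos hm hI n).trans_le ((le_abs_self _).trans (Complex.abs_im_le_norm _))
  set F : ℕ → ℂ → ℂ := fun n z => Φ^[n] z / (‖Φ^[n] Complex.I‖ : ℂ) with hF
  have hFd : ∀ n, DifferentiableOn ℂ (F n) {z : ℂ | 0 < z.im} := by
    intro n
    exact (hd.iterate hm n).div_const _
  have hFm : ∀ n, Set.MapsTo (F n) {z : ℂ | 0 < z.im} {z : ℂ | 0 < z.im} := by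
    intro n z hz
    change 0 < (Φ^[n] z / (‖Φ^[n] Complex.I‖ : ℂ)).im
    rw [Complex.div_ofReal_im]
    exact div_pos (iterate_im_pos hm hz n) (hIn n)
  have hopen : IsOpen {z : ℂ | 0 < z.im} := isOpen_lt continuous_const Complex.continuous_im
  have hGd : DifferentiableOn ℂ G {z : ℂ | 0 < z.im} := by
    refine (tendstoLocallyUniformlyOn_of_equicontinuousAt (F := F) hopen (fun x hx => ?_)
      fun x hx => (hG x hx).2).differentiableOn (Eventually.of_forall hFd) hopen
    obtain ⟨M, hM⟩ := (hG x hx).2.norm.bddAbove_range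
    exact equicontinuousAt_of_mapsTo_upperHalfPlane hFd hFm hx fun n => hM ⟨n, rfl⟩
  have hslit : ∀ z : ℂ, 0 < z.im → z ∈ Complex.slitPlane := fun z hz => Or.inr hz.ne'
  refine ⟨fun z => Complex.arg (G z), fun z hz => ⟨⟨?_, ?_⟩, ?_⟩,
    fun z => -Complex.I * Complex.log (G z), ?_, fun z _ => ?_⟩
  · have h := (hG z hz).1
    refine lt_of_le_of_ne (Complex.arg_nonneg_iff.2 h.le) fun h0 => ?_
    exact h.ne' (Complex.arg_eq_zero_iff.1 h0.symm).2
  · have h := (hG z hz).1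
    refine lt_of_le_of_ne (Complex.arg_le_pi _) fun h0 => ?_
    exact h.ne' (Complex.arg_eq_pi_iff.1 h0).2
  · refine ((Complex.continuousAt_arg (hslit _ (hG z hz).1)).tendsto.comp (hG z hz).2).congr
      fun n => ?_
    simp only [Function.comp_apply]
    rw [div_eq_mul_inv, ← Complex.ofReal_inv, Complex.arg_mul_real (inv_pos.2 (hIn n))]
  · exact (hGd.clog fun z hz => hslit _ (hG z hz).1).const_mul _
  · simp [Complex.log_im]
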